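/- For every n ≥ 5, the commutator subgroup Γ_2(H_n) = [H_n, H_n] of the group H_n is perfect, i.e. [Γ_2(H_n), Γ_2(H_n)] = Γ_2(H_n). -/

import Mathlib

/-- The free-group letter corresponding to the braid generator `σ_{i+1}`
(0-based index `i`) of the virtual braid group on `n` strands. -/
def σg (n : ℕ) (i : Fin (n-1)) : FreeGroup (Fin (n-1) ⊕ Fin (n-1)) := FreeGroup.of (Sum.inl i)

/-- The free-group letter corresponding to the virtual generator `ρ_{i+1}`
(0-based index `i`) of the virtual braid group on `n` strands. -/
def ρg (n : ℕ) (i : Fin (n-1)) : FreeGroup (Fin (n-1) ⊕ Fin (n-1)) := FreeGroup.of (Sum.inr i)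

/-- The defining relators of the virtual braid group `VB n`. -/
def vbRels (n : ℕ) : Set (FreeGroup (Fin (n-1) ⊕ Fin (n-1))) :=
  {r | ∃ i j : Fin (n-1),
    ((i:ℕ)+1 = (j:ℕ) ∧ r = σg n i * σg n j * σg n i * (σg n j * σg n i * σg n j)⁻¹) ∨
    (((i:ℕ)+2 ≤ (j:ℕ) ∨ (j:ℕ)+2 ≤ (i:ℕ)) ∧ r = σg n i * σg n j * (σg n j * σg n i)⁻¹) ∨
    ((i:ℕ)+1 = (j:ℕ) ∧ r = ρg n i * ρg n j * ρg n i * (ρg n j * ρg n i * ρg n j)⁻¹) ∨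
    (((i:ℕ)+2 ≤ (j:ℕ) ∨ (j:ℕ)+2 ≤ (i:ℕ)) ∧ r = ρg n i * ρg n j * (ρg n j * ρg n i)⁻¹) ∨
    (r = ρg n i * ρg n i) ∨
    (((i:ℕ)+2 ≤ (j:ℕ) ∨ (j:ℕ)+2 ≤ (i:ℕ)) ∧ r = σg n i * ρg n j * (ρg n j * σg n i)⁻¹) ∨
    ((i:ℕ)+1 = (j:ℕ) ∧ r = ρg n i * ρg n j * σg n i * (σg n j * ρg n i * ρg n j)⁻¹)}

/-- The virtual braid group on `n` strands, given by its standard presentation. -/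
abbrev VB (n : ℕ) : Type := PresentedGroup (vbRels n)

/-- The generator `σ_{i+1}` of `VB n`. -/
def σv (n : ℕ) (i : Fin (n-1)) : VB n := PresentedGroup.of (Sum.inl i)

/-- The generator `ρ_{i+1}` of `VB n`. -/
def ρv (n : ℕ) (i : Fin (n-1)) : VB n := PresentedGroup.of (Sum.inr i)

/-- The transposition `(i+1, i+2)` (0-based: swapping `i` and `i+1`) in `S_n`. -/
def sw (n : ℕ) (i : Fin (n-1)) : Equiv.Perm (Fin n) :=
  Equiv.swap ⟨i.val, by have := i.isLt; omega⟩ ⟨i.val + 1, by have := i.isLt; omega⟩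

/-- `μ : VB n → S_n` sends each `σ_i` to `1` and each `ρ_i` to the transposition `(i, i+1)`.
Its kernel is the normal closure `H_n` of the braid group `B_n` in `VB n`. -/
def IsMu (n : ℕ) (μ : VB n →* Equiv.Perm (Fin n)) : Prop :=
  ∀ i : Fin (n-1), μ (σv n i) = 1 ∧ μ (ρv n i) = sw n i

/-- `ν : VB n → S_n` sends both `σ_i` and `ρ_i` to the transposition `(i, i+1)`.
Its kernel is the virtual pure braid group `VP_n`. -/
def IsNu (n : ℕ) (ν : VB n →* Equiv.Perm (Fin n)) : Prop :=
  ∀ i : Fin (n-1), ν (σv n i) = sw n i ∧ ν (ρv n i) = sw n i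

/-- The descending product `s m * s (m - 1) * ⋯` with `j` factors. -/
def descProd {G : Type*} [Group G] (s : ℕ → G) (m : ℕ) : ℕ → G
  | 0 => 1
  | j + 1 => descProd s m j * s (m - j)

section Coxeter

variable {G : Type*} [Group G] {s : ℕ → G} {m N : ℕ}

lemma descProd_mul_of_lt (hc : ∀ i j, i + 2 ≤ j → j < N → s i * s j = s j * s i) (hm : m < N)
    {i j : ℕ} (hij : i + j + 1 ≤ m) : descProd s m j * s i = s i * descProd s m j := by
  induction j with
  | zero => simp [descProd]
  | succ j ih =>
    rw [descProd, mul_assoc, ← hc i (m - j) (by omega) (by omega), ← mul_assoc, ih (by omega),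
      mul_assoc]

lemma descProd_mul_of_gt (hc : ∀ i j, i + 2 ≤ j → j < N → s i * s j = s j * s i)
    (hb : ∀ i, i + 1 < N → s i * s (i + 1) * s i = s (i + 1) * s i * s (i + 1)) (hm : m < N)
    {i j : ℕ} (hj : j ≤ m) (hij : m ≤ i + j) (hi : i + 1 ≤ m) :
    descProd s m (j + 1) * s (i + 1) = s i * descProd s m (j + 1) := by
  induction j with
  | zero => omega
  | succ j ih =>
    rcases Nat.lt_or_ge (i + j) m with h | h
    · have h1 : m - j = i + 1 := by omega
      have h2 : m - (j + 1) = i := by omega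
      rw [descProd, descProd, h1, h2]
      calc descProd s m j * s (i + 1) * s i * s (i + 1)
          = descProd s m j * (s (i + 1) * s i * s (i + 1)) := by group
        _ = descProd s m j * s i * s (i + 1) * s i := by rw [← hb i (by omega)]; group
        _ = s i * (descProd s m j * s (i + 1) * s i) := by
          rw [descProd_mul_of_lt hc hm (by omega)]; group
    · rw [descProd, mul_assoc, hc (m - (j + 1)) (i + 1) (by omega) (by omega), ← mul_assoc,
        ih (by omega) h, mul_assoc]

lemma exists_eq_mul_descProd (hc : ∀ i j, i + 2 ≤ j → j < N → s i * s j = s j * s i)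
    (hb : ∀ i, i + 1 < N → s i * s (i + 1) * s i = s (i + 1) * s i * s (i + 1))
    (hs : ∀ i, i < N → s i * s i = 1) (hm : m < N) {g : G}
    (hg : g ∈ Subgroup.closure (s '' Set.Iio (m + 1))) :
    ∃ h ∈ Subgroup.closure (s '' Set.Iio m), ∃ j ≤ m + 1, g = h * descProd s m j := by
  have step : ∀ i, i < m + 1 → ∀ g,
      (∃ h ∈ Subgroup.closure (s '' Set.Iio m), ∃ j ≤ m + 1, g = h * descProd s m j) →
      ∃ h ∈ Subgroup.closure (s '' Set.Iio m), ∃ j ≤ m + 1, g * s i = h * descProd s m j := by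
    rintro i hi _ ⟨h, hh, j, hj, rfl⟩
    have mem : ∀ k, k < m → h * s k ∈ Subgroup.closure (s '' Set.Iio m) := fun k hk ↦
      mul_mem hh (Subgroup.subset_closure (Set.mem_image_of_mem s hk))
    rcases Nat.lt_trichotomy (i + j) m with h1 | h1 | h1
    · exact ⟨_, mem i (by omega), j, hj, by
        rw [mul_assoc, descProd_mul_of_lt hc hm (by omega), mul_assoc]⟩
    · exact ⟨h, hh, j + 1, by omega, by
        rw [mul_assoc, descProd, show m - j = i by omega]⟩
    · obtain ⟨j, rfl⟩ : ∃ k, j = k + 1 := ⟨j - 1, by omega⟩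
      rcases Nat.lt_or_ge m (i + j) with h2 | h2
      · obtain ⟨i, rfl⟩ : ∃ k, i = k + 1 := ⟨i - 1, by omega⟩
        exact ⟨_, mem i (by omega), j + 1, hj, by
          rw [mul_assoc, descProd_mul_of_gt hc hb hm (by omega) (by omega) (by omega), mul_assoc]⟩
      · exact ⟨h, hh, j, by omega, by
          rw [descProd, show m - j = i by omega, mul_assoc, mul_assoc, hs i (by omega), mul_one]⟩
  induction hg using Subgroup.closure_induction_right with
  | one => exact ⟨1, one_mem _, 0, by omega, by simp [descProd]⟩
  | mul_right x hx y hy ih =>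
    obtain ⟨i, hi, rfl⟩ := hy
    exact step i hi x ih
  | mul_inv_cancel x hx y hy ih =>
    obtain ⟨i, hi, rfl⟩ := hy
    rw [inv_eq_of_mul_eq_one_right (hs i (by simp at hi; omega))]
    exact step i hi x ih

/-- Elements satisfying the Coxeter relations of type `A` generate a subgroup on which any
homomorphism sending them to the adjacent transpositions is injective. -/
lemma eq_one_of_mem_closure_of_map_eq_one
    (hc : ∀ i j, i + 2 ≤ j → j < N → s i * s j = s j * s i)
    (hb : ∀ i, i + 1 < N → s i * s (i + 1) * s i = s (i + 1) * s i * s (i + 1))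
    (hs : ∀ i, i < N → s i * s i = 1) (φ : G →* Equiv.Perm ℕ)
    (hφ : ∀ i, i < N → φ (s i) = Equiv.swap i (i + 1)) (hm : m ≤ N) {g : G}
    (hg : g ∈ Subgroup.closure (s '' Set.Iio m)) (h1 : φ g = 1) : g = 1 := by
  induction m generalizing g with
  | zero => simpa using hg
  | succ m ih =>
    obtain ⟨h, hh, j, hj, rfl⟩ := exists_eq_mul_descProd hc hb hs hm hg
    have fix : φ h (m + 1) = m + 1 := by
      have : Subgroup.closure (s '' Set.Iio m) ≤
          (MulAction.stabilizer (Equiv.Perm ℕ) (m + 1)).comap φ := by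
        rw [Subgroup.closure_le]
        rintro _ ⟨i, hi, rfl⟩
        have hi : i < m := hi
        simp [hφ i (by omega), Equiv.swap_apply_of_ne_of_ne (show m + 1 ≠ i by omega)
          (show m + 1 ≠ i + 1 by omega)]
      exact this hh
    have move : ∀ j ≤ m + 1, φ (descProd s m j) (m + 1 - j) = m + 1 := by
      intro j hj
      induction j with
      | zero => simp [descProd]
      | succ j ih =>
        rw [descProd, map_mul, hφ _ (by omega), Equiv.Perm.mul_apply,
          show m + 1 - (j + 1) = m - j by omega, Equiv.swap_apply_left,
          show m - j + 1 = m + 1 - j by omega]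
        exact ih (by omega)
    have key : φ (h * descProd s m j) (m + 1 - j) = m + 1 := by
      rw [map_mul, Equiv.Perm.mul_apply, move j hj, fix]
    rw [h1, Equiv.Perm.one_apply] at key
    obtain rfl : j = 0 := by omega
    rw [descProd, mul_one] at h1 ⊢
    exact ih (by omega) hh h1

end Coxeter

section Metabelian

open scoped commutatorElement

variable {G : Type*} [Group G]

lemma Subgroup.mul_inv_mem_commutator_of_braid {H : Subgroup G} {a b : G} (ha : a ∈ H)
    (hb : b ∈ H) (h : a * b * a = b * a * b) : b * a⁻¹ ∈ ⁅H, H⁆ := by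
  have : b * a⁻¹ = ⁅a * b, a⁆ := by
    rw [commutatorElement_def, h]
    group
  rw [this]
  exact Subgroup.commutator_mem_commutator (mul_mem ha hb) ha

lemma eq_of_braid_of_mul_comm {a b : G} (h : a * b * a = b * a * b) (hc : a * b = b * a) :
    a = b := by
  rw [hc] at h
  exact mul_left_cancel h

variable {x : ℕ → G} {N : ℕ}

lemma eq_zero_of_braid_of_metabelian (hN : 4 ≤ N) {H : Subgroup G} (hx : ∀ i, i < N → x i ∈ H)
    (hc : ∀ i j, i + 2 ≤ j → j < N → x i * x j = x j * x i)
    (hb : ∀ i, i + 1 < N → x i * x (i + 1) * x i = x (i + 1) * x i * x (i + 1))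
    (hH : ⁅⁅H, H⁆, ⁅H, H⁆⁆ = ⊥) {i : ℕ} (hi : i < N) : x i = x 0 := by
  have d : ∀ i, i + 1 < N → x (i + 1) * (x i)⁻¹ ∈ ⁅H, H⁆ := fun i hi ↦
    Subgroup.mul_inv_mem_commutator_of_braid (hx i (by omega)) (hx _ hi) (hb i hi)
  have q : x 3 * (x 1)⁻¹ ∈ ⁅H, H⁆ := by
    have := mul_mem (d 2 (by omega)) (d 1 (by omega))
    simpa [mul_assoc] using this
  have p : x 3 * (x 0)⁻¹ ∈ ⁅H, H⁆ := by
    have := mul_mem q (d 0 (by omega))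
    simpa [mul_assoc] using this
  have pq : Commute (x 3 * (x 0)⁻¹) (x 3 * (x 1)⁻¹) := by
    have := Subgroup.commutator_mem_commutator p q
    rwa [hH, Subgroup.mem_bot, commutatorElement_eq_one_iff_commute] at this
  have c0 : Commute (x 3) (x 0) := (hc 0 3 (by omega) (by omega)).symm
  have c1 : Commute (x 3) (x 1) := (hc 1 3 (by omega) (by omega)).symm
  have e : Commute (x 0) (x 1) := by
    have h3 : Commute (x 3) (x 3 * (x 1)⁻¹) := (Commute.refl _).mul_right c1.inv_right
    have h0 : Commute (x 0)⁻¹ (x 3 * (x 1)⁻¹) := by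
      simpa using h3.inv_left.mul_left pq
    have := c0.symm.inv_left.inv_right.mul_right h0
    exact Commute.inv_inv_iff.1 (by simpa using this)
  have x1 : x 1 = x 0 := (eq_of_braid_of_mul_comm (hb 0 (by omega)) e).symm
  induction i with
  | zero => rfl
  | succ i ih =>
    rcases Nat.eq_zero_or_pos i with rfl | h
    · exact x1
    · have hxi := ih (by omega)
      have := eq_of_braid_of_mul_comm (hb i hi)
        (by rw [hxi]; exact hc 0 (i + 1) (by omega) hi)
      rw [← this, hxi]

/-- A quotient of a virtual braid group on at least five strands in which the kernel of the
homomorphism to the symmetric group becomes metabelian has abelian such kernel. -/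
lemma commutator_ker_eq_bot_of_metabelian {ρ : ℕ → G} (hN : 4 ≤ N)
    (hxc : ∀ i j, i + 2 ≤ j → j < N → x i * x j = x j * x i)
    (hxb : ∀ i, i + 1 < N → x i * x (i + 1) * x i = x (i + 1) * x i * x (i + 1))
    (hρc : ∀ i j, i + 2 ≤ j → j < N → ρ i * ρ j = ρ j * ρ i)
    (hρb : ∀ i, i + 1 < N → ρ i * ρ (i + 1) * ρ i = ρ (i + 1) * ρ i * ρ (i + 1))
    (hρ : ∀ i, i < N → ρ i * ρ i = 1)
    (hxρ : ∀ i j, i < N → j < N → (i + 2 ≤ j ∨ j + 2 ≤ i) → x i * ρ j = ρ j * x i)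
    (hgen : Subgroup.closure (x '' Set.Iio N ∪ ρ '' Set.Iio N) = ⊤)
    (φ : G →* Equiv.Perm ℕ) (hφx : ∀ i, i < N → φ (x i) = 1)
    (hφρ : ∀ i, i < N → φ (ρ i) = Equiv.swap i (i + 1))
    (hH : ⁅⁅φ.ker, φ.ker⁆, ⁅φ.ker, φ.ker⁆⁆ = ⊥) : ⁅φ.ker, φ.ker⁆ = ⊥ := by
  have hx0 : ∀ i, i < N → x i = x 0 := fun i hi ↦
    eq_zero_of_braid_of_metabelian hN (H := φ.ker) hφx hxc hxb hH hi
  have hcomm : ∀ i, i < N → x 0 * ρ i = ρ i * x 0 := by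
    intro i hi
    rcases Nat.lt_or_ge i 2 with h | h
    · rw [← hx0 3 (by omega)]
      exact hxρ 3 i (by omega) hi (by omega)
    · exact hxρ 0 i (by omega) hi (by omega)
  have hcent : Subgroup.zpowers (x 0) ≤ Subgroup.center G := by
    rw [Subgroup.zpowers_le, ← Subgroup.centralizer_univ, ← Subgroup.coe_top, ← hgen,
      Subgroup.centralizer_closure, Subgroup.mem_centralizer_iff]
    rintro _ (⟨i, hi, rfl⟩ | ⟨i, hi, rfl⟩)
    · rw [hx0 i hi]
    · exact (hcomm i hi).symm
  have : (Subgroup.zpowers (x 0)).Normal :=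
    ⟨fun z hz g ↦ by rwa [Subgroup.mem_center_iff.1 (hcent hz) g, mul_inv_cancel_right]⟩
  have hker : φ.ker ≤ Subgroup.zpowers (x 0) := by
    intro g hg
    have htop : Subgroup.zpowers (x 0) ⊔ Subgroup.closure (ρ '' Set.Iio N) = ⊤ := by
      rw [eq_top_iff, ← hgen, Subgroup.closure_le]
      rintro _ (⟨i, hi, rfl⟩ | hr)
      · rw [hx0 i hi]
        exact Subgroup.mem_sup_left (Subgroup.mem_zpowers _)
      · exact Subgroup.mem_sup_right (Subgroup.subset_closure hr)
    obtain ⟨z, hz, r, hr, rfl⟩ := Subgroup.mem_sup_of_normal_left.1 (htop ▸ Subgroup.mem_top g)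
    have hz1 : φ z = 1 := by
      have : Subgroup.zpowers (x 0) ≤ φ.ker := by
        rw [Subgroup.zpowers_le]
        exact hφx 0 (by omega)
      exact this hz
    have hr1 : r = 1 := by
      refine eq_one_of_mem_closure_of_map_eq_one hρc hρb hρ φ hφρ le_rfl hr ?_
      simpa [MonoidHom.mem_ker, hz1] using hg
    simpa [hr1] using hz
  rw [Subgroup.commutator_eq_bot_iff_le_centralizer]
  exact fun g hg ↦ Subgroup.center_le_centralizer _ (hcent (hker hg))

end Metabelian

section VirtualBraid

variable {n : ℕ}

lemma VB.eq_of_mul_inv_mem {a b : FreeGroup (Fin (n - 1) ⊕ Fin (n - 1))}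
    (h : a * b⁻¹ ∈ vbRels n) : PresentedGroup.mk (vbRels n) a = PresentedGroup.mk (vbRels n) b :=
  PresentedGroup.mk_eq_mk_of_mul_inv_mem h

lemma σv_braid {i j : Fin (n - 1)} (h : (i : ℕ) + 1 = j) :
    σv n i * σv n j * σv n i = σv n j * σv n i * σv n j :=
  VB.eq_of_mul_inv_mem (a := σg n i * σg n j * σg n i) (b := σg n j * σg n i * σg n j)
    ⟨i, j, .inl ⟨h, rfl⟩⟩

lemma σv_comm {i j : Fin (n - 1)} (h : (i : ℕ) + 2 ≤ j) : σv n i * σv n j = σv n j * σv n i :=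
  VB.eq_of_mul_inv_mem (a := σg n i * σg n j) (b := σg n j * σg n i)
    ⟨i, j, .inr (.inl ⟨.inl h, rfl⟩)⟩

lemma ρv_braid {i j : Fin (n - 1)} (h : (i : ℕ) + 1 = j) :
    ρv n i * ρv n j * ρv n i = ρv n j * ρv n i * ρv n j :=
  VB.eq_of_mul_inv_mem (a := ρg n i * ρg n j * ρg n i) (b := ρg n j * ρg n i * ρg n j)
    ⟨i, j, .inr (.inr (.inl ⟨h, rfl⟩))⟩

lemma ρv_comm {i j : Fin (n - 1)} (h : (i : ℕ) + 2 ≤ j) : ρv n i * ρv n j = ρv n j * ρv n i :=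
  VB.eq_of_mul_inv_mem (a := ρg n i * ρg n j) (b := ρg n j * ρg n i)
    ⟨i, j, .inr (.inr (.inr (.inl ⟨.inl h, rfl⟩)))⟩

lemma ρv_mul_self (i : Fin (n - 1)) : ρv n i * ρv n i = 1 :=
  PresentedGroup.one_of_mem (x := ρg n i * ρg n i)
    ⟨i, i, .inr (.inr (.inr (.inr (.inl rfl))))⟩

lemma σv_ρv_comm {i j : Fin (n - 1)} (h : (i : ℕ) + 2 ≤ j ∨ (j : ℕ) + 2 ≤ i) :
    σv n i * ρv n j = ρv n j * σv n i :=
  VB.eq_of_mul_inv_mem (a := σg n i * ρg n j) (b := ρg n j * σg n i)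
    ⟨i, j, .inr (.inr (.inr (.inr (.inr (.inl ⟨h, rfl⟩)))))⟩

lemma closure_σv_union_ρv :
    Subgroup.closure (Set.range (σv n) ∪ Set.range (ρv n)) = ⊤ := by
  rw [eq_top_iff, ← PresentedGroup.closure_range_of, Subgroup.closure_le]
  rintro _ ⟨i | i, rfl⟩
  · exact Subgroup.subset_closure (.inl ⟨i, rfl⟩)
  · exact Subgroup.subset_closure (.inr ⟨i, rfl⟩)

lemma viaEmbeddingHom_sw (i : Fin (n - 1)) :
    Equiv.Perm.viaEmbeddingHom Fin.valEmbedding (sw n i) = Equiv.swap (i : ℕ) (i + 1) := by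
  ext k
  rw [Equiv.Perm.viaEmbeddingHom_apply]
  by_cases hk : k < n
  · have h := Equiv.Perm.viaEmbedding_apply (sw n i) Fin.valEmbedding ⟨k, hk⟩
    simp only [Fin.valEmbedding_apply] at h
    rw [h, sw, Equiv.swap_apply_def, Equiv.swap_apply_def]
    simp only [Fin.ext_iff]
    split_ifs <;> rfl
  · rw [Equiv.Perm.viaEmbedding_apply_of_notMem, Equiv.swap_apply_of_ne_of_ne] <;>
      first | omega | (rintro ⟨a, rfl⟩; exact hk a.2)

end VirtualBraid

/-- For every `n ≥ 5`, the commutator subgroup `Γ_2(H_n) = [H_n, H_n]`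
of the group `H_n = ker μ` is perfect. -/
theorem hn_commutator_perfect (n : ℕ) (hn : 5 ≤ n)
    (μ : VB n →* Equiv.Perm (Fin n)) (hμ : IsMu n μ) :
    ⁅commutator ↥μ.ker, commutator ↥μ.ker⁆ = commutator ↥μ.ker := by
  have hcomm : (commutator μ.ker).map μ.ker.subtype = ⁅μ.ker, μ.ker⁆ := by
    rw [commutator_def, Subgroup.map_commutator, ← MonoidHom.range_eq_map, Subgroup.range_subtype]
  refine Subgroup.map_injective μ.ker.subtype_injective ?_
  rw [Subgroup.map_commutator, hcomm]
  refine le_antisymm (Subgroup.commutator_le_right _ _) ?_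
  set D := ⁅⁅μ.ker, μ.ker⁆, ⁅μ.ker, μ.ker⁆⁆ with hD
  have hDker : D ≤ μ.ker := (Subgroup.commutator_le_right _ _).trans
    (Subgroup.commutator_le_right _ _)
  let ι := Equiv.Perm.viaEmbeddingHom (Fin.valEmbedding (n := n))
  let φ : VB n ⧸ D →* Equiv.Perm ℕ := ι.comp (QuotientGroup.lift D μ hDker)
  let π := QuotientGroup.mk' D
  have hker : φ.ker = μ.ker.map π := by
    ext q
    obtain ⟨g, rfl⟩ := QuotientGroup.mk'_surjective D q
    have hl : g ∈ μ.ker ↔ π g ∈ μ.ker.map π := by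
      rw [← Subgroup.mem_comap, Subgroup.comap_map_eq_self]
      rwa [QuotientGroup.ker_mk']
    rw [← hl, MonoidHom.mem_ker, MonoidHom.mem_ker]
    exact map_eq_one_iff ι (Equiv.Perm.viaEmbeddingHom_injective _)
  let x : ℕ → VB n ⧸ D := fun i ↦ if h : i < n - 1 then π (σv n ⟨i, h⟩) else 1
  let ρ : ℕ → VB n ⧸ D := fun i ↦ if h : i < n - 1 then π (ρv n ⟨i, h⟩) else 1
  have hx : ∀ i (h : i < n - 1), x i = π (σv n ⟨i, h⟩) := fun i h ↦ dif_pos h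
  have hρ : ∀ i (h : i < n - 1), ρ i = π (ρv n ⟨i, h⟩) := fun i h ↦ dif_pos h
  have main : ⁅φ.ker, φ.ker⁆ = ⊥ := by
    apply commutator_ker_eq_bot_of_metabelian (x := x) (ρ := ρ) (N := n - 1) (by omega)
    · intro i j hij hj
      rw [hx i (by omega), hx j hj, ← map_mul, σv_comm hij, map_mul]
    · intro i hi
      rw [hx i (by omega), hx _ hi]
      simp only [← map_mul]
      rw [σv_braid rfl]
    · intro i j hij hj
      rw [hρ i (by omega), hρ j hj, ← map_mul, ρv_comm hij, map_mul]
    · intro i hi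
      rw [hρ i (by omega), hρ _ hi]
      simp only [← map_mul]
      rw [ρv_braid rfl]
    · intro i hi
      rw [hρ i hi, ← map_mul, ρv_mul_self, map_one]
    · intro i j hi hj hij
      rw [hx i hi, hρ j hj, ← map_mul, σv_ρv_comm hij, map_mul]
    · rw [eq_top_iff, ← Subgroup.map_top_of_surjective π (QuotientGroup.mk'_surjective D),
        ← closure_σv_union_ρv, MonoidHom.map_closure, Subgroup.closure_le]
      rintro _ ⟨_, ⟨i, rfl⟩ | ⟨i, rfl⟩, rfl⟩
      · exact Subgroup.subset_closure (.inl ⟨i, i.2, hx i i.2⟩)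
      · exact Subgroup.subset_closure (.inr ⟨i, i.2, hρ i i.2⟩)
    · intro i hi
      rw [hx i hi]
      change ι (μ _) = 1
      rw [(hμ _).1, map_one]
    · intro i hi
      rw [hρ i hi]
      change ι (μ _) = _
      rw [(hμ _).2]
      exact viaEmbeddingHom_sw _
    · rw [hker, ← Subgroup.map_commutator, ← Subgroup.map_commutator, ← hD,
        Subgroup.map_eq_bot_iff, QuotientGroup.ker_mk']
  rwa [hker, ← Subgroup.map_commutator, Subgroup.map_eq_bot_iff, QuotientGroup.ker_mk'] at main
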